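/- Let S² be the unit sphere in ℝ³ centred at the origin and let V ⊆ S² be a finite set with |V| ≥ 8. Then the number N(V) of double-normal pairs of V (regarded as a subset of ℝ³) satisfies N(V) ≤ (17/4)|V| − 6. -/

import Mathlib

open scoped RealInnerProductSpace Classical

noncomputable section

abbrev Euc (d : ℕ) : Type := EuclideanSpace ℝ (Fin d)

/-- `{p, q}` is a double-normal pair of the finite point set `V`. -/
def IsDNPair {d : ℕ} (V : Finset (Euc d)) (p q : Euc d) : Prop :=
  p ∈ V ∧ q ∈ V ∧ p ≠ q ∧
    ∀ v ∈ V, 0 ≤ ⟪v - p, q - p⟫ ∧ 0 ≤ ⟪v - q, p - q⟫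

/-- `N(V)`: the number of (unordered) double-normal pairs of `V`. -/
def numDN {d : ℕ} (V : Finset (Euc d)) : ℕ :=
  ((V ×ˢ V).filter fun pq => IsDNPair V pq.1 pq.2).card / 2

/-- `{p, q}` is a strict double-normal pair of `V`. -/
def IsStrictDNPair {d : ℕ} (V : Finset (Euc d)) (p q : Euc d) : Prop :=
  IsDNPair V p q ∧
    ∀ v ∈ V, v ≠ p → v ≠ q → 0 < ⟪v - p, q - p⟫ ∧ 0 < ⟪v - q, p - q⟫

/-- `N'(V)`: the number of (unordered) strict double-normal pairs of `V`. -/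
def numStrictDN {d : ℕ} (V : Finset (Euc d)) : ℕ :=
  ((V ×ˢ V).filter fun pq => IsStrictDNPair V pq.1 pq.2).card / 2

/-! ## Linear algebra in three-space -/

lemma exists_rel_of_perp {h a b c : Euc 3} (h0 : h ≠ 0) (ha : ⟪h, a⟫ = 0) (hb : ⟪h, b⟫ = 0)
    (hc : ⟪h, c⟫ = 0) :
    ∃ α β γ : ℝ, ¬ (α = 0 ∧ β = 0 ∧ γ = 0) ∧ α • a + β • b + γ • c = 0 := by
  by_contra hcon
  push Not at hcon
  have hli : LinearIndependent ℝ ![a, b, c] := by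
    rw [Fintype.linearIndependent_iff]
    intro g hg
    simp [Fin.sum_univ_three] at hg
    by_contra hne
    have := hcon (g 0) (g 1) (g 2) (fun h h' h'' => hne (by
      intro i; fin_cases i <;> simp [h, h', h'']))
    exact this hg
  have htop := hli.span_eq_top_of_card_eq_finrank (by simp)
  have hmem : h ∈ Submodule.span ℝ (Set.range ![a, b, c]) := by rw [htop]; trivial
  have hle : Submodule.span ℝ (Set.range ![a, b, c]) ≤ (ℝ ∙ h)ᗮ := by
    rw [Submodule.span_le]
    rintro x ⟨i, rfl⟩
    simp only [SetLike.mem_coe, Submodule.mem_orthogonal_singleton_iff_inner_right]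
    fin_cases i <;> simp [ha, hb, hc]
  have := hle hmem
  rw [Submodule.mem_orthogonal_singleton_iff_inner_right] at this
  exact h0 (inner_self_eq_zero.mp this)

lemma indep_sphere {u w x : Euc 3} (hu : ‖u‖ = 1) (hw : ‖w‖ = 1) (hx : ‖x‖ = 1)
    (h1 : w ≠ u) (h2 : x ≠ u) (h3 : w ≠ x) {α β : ℝ}
    (h : α • (w - u) + β • (x - u) = 0) : α = 0 ∧ β = 0 := by
  have huu : ⟪u, u⟫ = 1 := by rw [real_inner_self_eq_norm_sq, hu]; norm_num
  have hww : ⟪w, w⟫ = 1 := by rw [real_inner_self_eq_norm_sq, hw]; norm_num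
  have hxx : ⟪x, x⟫ = 1 := by rw [real_inner_self_eq_norm_sq, hx]; norm_num
  have p1 : ⟪u, w⟫ < 1 := by rw [inner_lt_one_iff_real_of_norm_eq_one hu hw]; exact h1.symm
  have p2 : ⟪u, x⟫ < 1 := by rw [inner_lt_one_iff_real_of_norm_eq_one hu hx]; exact h2.symm
  have p3 : ⟪w, x⟫ < 1 := by rw [inner_lt_one_iff_real_of_norm_eq_one hw hx]; exact h3
  have e1 := congrArg (fun z => ⟪z, u⟫) h
  have e2 := congrArg (fun z => ⟪z, w⟫) h
  have e3 := congrArg (fun z => ⟪z, x⟫) h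
  simp only [inner_add_left, inner_sub_left, inner_smul_left, inner_zero_left, huu, hww, hxx,
    conj_trivial, real_inner_comm u w, real_inner_comm u x, real_inner_comm w x] at e1 e2 e3
  generalize ⟪u, w⟫ = p at *
  generalize ⟪u, x⟫ = q at *
  generalize ⟪w, x⟫ = r at *
  have hp : 1 - p ≠ 0 := by linarith
  have hq : 1 - q ≠ 0 := by linarith
  have hr : 1 - r ≠ 0 := by linarith
  -- e1 : α (p-1) + β (q-1) = 0 ; e2 : α(1-p)+β(r-p)=0
  have hβ : β = 0 := by
    by_contra hb
    have a1 : β * ((r - p) + (q - 1)) = 0 := by linarith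
    have a2 : r - p + (q - 1) = 0 := by
      rcases mul_eq_zero.mp a1 with h | h
      · exact absurd h hb
      · exact h
    have ha : α ≠ 0 := by
      rintro rfl
      have : β * (1 - q) = 0 := by linarith
      rcases mul_eq_zero.mp this with h | h
      · exact hb h
      · exact hq h
    have a3 : α * ((p - 1) + (r - q)) = 0 := by linarith
    have a4 : p - 1 + (r - q) = 0 := by
      rcases mul_eq_zero.mp a3 with h | h
      · exact absurd h ha
      · exact h
    apply hr; linarith
  subst hβ
  refine ⟨?_, rfl⟩
  have : α * (1 - p) = 0 := by linarith
  rcases mul_eq_zero.mp this with h | h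
  · exact h
  · exact absurd h hp

lemma plane_unique {u w x n m : Euc 3} (hu : ‖u‖ = 1) (hw : ‖w‖ = 1) (hx : ‖x‖ = 1)
    (h1 : w ≠ u) (h2 : x ≠ u) (h3 : w ≠ x)
    (nu : ⟪n, u⟫ = 1) (nw : ⟪n, w⟫ = 1) (nx : ⟪n, x⟫ = 1)
    (mu : ⟪m, u⟫ = 1) (mw : ⟪m, w⟫ = 1) (mx : ⟪m, x⟫ = 1) : n = m := by
  by_contra hne
  obtain ⟨α, β, γ, h0, hr⟩ := exists_rel_of_perp (h := n - m) (a := u) (b := w) (c := x)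
    (sub_ne_zero.mpr hne) (by rw [inner_sub_left]; linarith) (by rw [inner_sub_left]; linarith)
    (by rw [inner_sub_left]; linarith)
  have e := congrArg (fun z => ⟪n, z⟫) hr
  simp only [inner_add_right, inner_smul_right, nu, nw, nx, inner_zero_right] at e
  have hα : α = - β - γ := by linarith
  have := indep_sphere hu hw hx h1 h2 h3 (α := β) (β := γ) (by
    rw [← hr, hα]; module)
  apply h0
  refine ⟨by rw [hα, this.1, this.2]; simp, this.1, this.2⟩

def cr (u w : Euc 3) : Euc 3 :=
  !₂[u 1 * w 2 - u 2 * w 1, u 2 * w 0 - u 0 * w 2, u 0 * w 1 - u 1 * w 0]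

lemma inner3 (x y : Euc 3) : ⟪x, y⟫ = x 0 * y 0 + x 1 * y 1 + x 2 * y 2 := by
  simp [PiLp.inner_apply, Fin.sum_univ_three]; ring

lemma cr_left (u w : Euc 3) : ⟪cr u w, u⟫ = 0 := by
  rw [inner3]; simp [cr]; ring
lemma cr_right (u w : Euc 3) : ⟪cr u w, w⟫ = 0 := by
  rw [inner3]; simp [cr]; ring
lemma cr_swap (u w x : Euc 3) : ⟪cr u w, x⟫ = - ⟪cr w u, x⟫ := by
  rw [inner3, inner3]; simp [cr]; ring
lemma cr_swap' (u w x : Euc 3) : ⟪cr u w, x⟫ = - ⟪cr u x, w⟫ := by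
  rw [inner3, inner3]; simp [cr]; ring
lemma cr_self (u w : Euc 3) : ⟪cr u w, cr u w⟫ = ⟪u, u⟫ * ⟪w, w⟫ - ⟪u, w⟫ ^ 2 := by
  simp only [inner3]; simp [cr]; ring

lemma inner_lt_one' {u w : Euc 3} (hu : ‖u‖ = 1) (hw : ‖w‖ = 1) (h : u ≠ w) : ⟪u, w⟫ < 1 := by
  rw [inner_lt_one_iff_real_of_norm_eq_one hu hw]; exact h

lemma neg_one_lt_inner {u w : Euc 3} (hu : ‖u‖ = 1) (hw : ‖w‖ = 1) (h : u ≠ -w) :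
    -1 < ⟪u, w⟫ := by
  have := inner_lt_one' hu (w := -w) (by simpa using hw) h
  rw [inner_neg_right] at this; linarith

lemma self_one {u : Euc 3} (hu : ‖u‖ = 1) : ⟪u, u⟫ = 1 := by
  rw [real_inner_self_eq_norm_sq, hu]; norm_num

lemma cr_ne_zero {u w : Euc 3} (hu : ‖u‖ = 1) (hw : ‖w‖ = 1) (h : u ≠ w) (h' : u ≠ -w) :
    cr u w ≠ 0 := by
  intro h0
  have := cr_self u w
  rw [h0, inner_zero_left, self_one hu, self_one hw] at this
  have a := inner_lt_one' hu hw h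
  have b := neg_one_lt_inner hu hw h'
  nlinarith

lemma exists_generic (W : Finset (Euc 3)) : ∃ h : Euc 3, ∀ x ∈ W, ∀ y ∈ W,
    ⟪h, x⟫ = ⟪h, y⟫ → x = y := by
  by_contra hcon
  push Not at hcon
  have : (⋃ p : W.offDiag, (((ℝ ∙ (p.1.1 - p.1.2))ᗮ : Submodule ℝ (Euc 3)) : Set (Euc 3)))
      = Set.univ := by
    ext h
    simp only [Set.mem_iUnion, Set.mem_univ, iff_true]
    obtain ⟨x, hx, y, hy, he, hne⟩ := hcon h
    refine ⟨⟨(x, y), by simp [hx, hy, hne]⟩, ?_⟩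
    simp only [SetLike.mem_coe, Submodule.mem_orthogonal_singleton_iff_inner_left]
    rw [inner_sub_right, he, sub_self]
  obtain ⟨⟨⟨x, y⟩, hp⟩, ht⟩ := Subspace.exists_eq_top_of_iUnion_eq_univ this
  have hmem : x - y ∈ (ℝ ∙ (x - y))ᗮ := by rw [ht]; trivial
  rw [Submodule.mem_orthogonal_singleton_iff_inner_left] at hmem
  have := inner_self_eq_zero.mp hmem
  simp at hp
  exact hp.2.2 (sub_eq_zero.mp this)
/-! ## Facets of the convex hull -/

def Feas (W : Finset (Euc 3)) (n : Euc 3) : Prop := ∀ x ∈ W, ⟪n, x⟫ ≤ 1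

def face (W : Finset (Euc 3)) (n : Euc 3) : Finset (Euc 3) := W.filter fun x => ⟪n, x⟫ = 1

lemma mem_face {W : Finset (Euc 3)} {n x : Euc 3} : x ∈ face W n ↔ x ∈ W ∧ ⟪n, x⟫ = 1 := by
  simp [face]

def Sph (W : Finset (Euc 3)) : Prop := ∀ x ∈ W, ‖x‖ = 1

def IsFacet (W : Finset (Euc 3)) (n : Euc 3) : Prop := Feas W n ∧ 3 ≤ (face W n).card

lemma facets_finite {W : Finset (Euc 3)} (hW : Sph W) : {n | IsFacet W n}.Finite := by
  apply Set.Finite.of_finite_image (f := face W)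
  · apply Set.Finite.subset (W.powerset.finite_toSet)
    rintro _ ⟨n, -, rfl⟩
    rw [Finset.mem_coe, Finset.mem_powerset]
    exact Finset.filter_subset _ _
  · intro n hn m hm he
    have h3 : 2 < (face W n).card := hn.2
    obtain ⟨a, b, c, ha, hb, hc, hab, hac, hbc⟩ := Finset.two_lt_card_iff.mp h3
    have ha' : a ∈ face W m := by rw [← he]; exact ha
    have hb' : b ∈ face W m := by rw [← he]; exact hb
    have hc' : c ∈ face W m := by rw [← he]; exact hc
    rw [mem_face] at *
    exact plane_unique (hW _ ha.1) (hW _ hb.1) (hW _ hc.1) hab.symm hac.symm hbc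
      ha.2 hb.2 hc.2 ha'.2 hb'.2 hc'.2

def facets (W : Finset (Euc 3)) : Finset (Euc 3) :=
  if h : {n | IsFacet W n}.Finite then h.toFinset else ∅

lemma mem_facets {W : Finset (Euc 3)} (hW : Sph W) {n : Euc 3} :
    n ∈ facets W ↔ IsFacet W n := by
  simp [facets, facets_finite hW]

lemma three_rays {h n₁ n₂ n₃ r₁ r₂ r₃ : Euc 3} (h0 : h ≠ 0)
    (h1 : ⟪h, r₁⟫ = 0) (h2 : ⟪h, r₂⟫ = 0) (h3 : ⟪h, r₃⟫ = 0)
    (e1 : ⟪n₁, r₁⟫ = 0) (e2 : ⟪n₂, r₂⟫ = 0) (e3 : ⟪n₃, r₃⟫ = 0)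
    (l12 : ⟪n₁, r₂⟫ < 0) (l13 : ⟪n₁, r₃⟫ < 0) (l21 : ⟪n₂, r₁⟫ < 0)
    (l23 : ⟪n₂, r₃⟫ < 0) (l31 : ⟪n₃, r₁⟫ < 0) (l32 : ⟪n₃, r₂⟫ < 0) : False := by
  obtain ⟨α, β, γ, hne, hr⟩ := exists_rel_of_perp h0 h1 h2 h3
  have q1 := congrArg (fun z => ⟪n₁, z⟫) hr
  have q2 := congrArg (fun z => ⟪n₂, z⟫) hr
  have q3 := congrArg (fun z => ⟪n₃, z⟫) hr
  simp only [inner_add_right, inner_smul_right, e1, e2, e3, inner_zero_right] at q1 q2 q3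
  generalize ⟪n₁, r₂⟫ = a at *
  generalize ⟪n₁, r₃⟫ = b at *
  generalize ⟪n₂, r₁⟫ = c at *
  generalize ⟪n₂, r₃⟫ = d at *
  generalize ⟪n₃, r₁⟫ = e at *
  generalize ⟪n₃, r₂⟫ = f at *
  rcases lt_trichotomy α 0 with ha | ha | ha
  · have hγ : 0 < γ := by by_contra hh; nlinarith [mul_pos_of_neg_of_neg ha l21]
    have hβ : 0 < β := by by_contra hh; nlinarith [mul_pos_of_neg_of_neg ha l31]
    nlinarith [mul_pos_of_neg_of_neg (neg_neg_of_pos hγ) l13,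
      mul_pos_of_neg_of_neg (neg_neg_of_pos hβ) l12]
  · subst ha
    apply hne
    refine ⟨rfl, ?_, ?_⟩
    · have : β * f = 0 := by linarith
      exact (mul_eq_zero.mp this).resolve_right l32.ne
    · have : γ * d = 0 := by linarith
      exact (mul_eq_zero.mp this).resolve_right l23.ne
  · have hγ : γ < 0 := by by_contra hh; nlinarith [mul_neg_of_pos_of_neg ha l21]
    have hβ : β < 0 := by by_contra hh; nlinarith [mul_neg_of_pos_of_neg ha l31]
    nlinarith [mul_pos_of_neg_of_neg hγ l13, mul_pos_of_neg_of_neg hβ l12]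

/-- a direction pointing into facet `m` at `v` is strictly below any other facet through `v` -/
lemma ray_neg {W : Finset (Euc 3)} (hW : Sph W) {n m v a b : Euc 3} (hn : Feas W n)
    (hne : n ≠ m)
    (hvn : v ∈ face W n) (hvm : v ∈ face W m) (ha : a ∈ face W m) (hb : b ∈ face W m)
    (hav : a ≠ v) (hbv : b ≠ v) (hab : a ≠ b) {s t : ℝ} (hs : 0 < s) (ht : 0 < t) :
    ⟪n, s • (a - v) + t • (b - v)⟫ < 0 := by
  rw [mem_face] at *
  have h1 := hn a ha.1
  have h2 := hn b hb.1
  simp only [inner_add_right, inner_smul_right, inner_sub_right, hvn.2]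
  by_contra hcon
  have h3 : ⟪n, a⟫ = 1 := by
    by_contra hh
    have : ⟪n, a⟫ < 1 := lt_of_le_of_ne h1 hh
    nlinarith
  have h4 : ⟪n, b⟫ = 1 := by
    by_contra hh
    have : ⟪n, b⟫ < 1 := lt_of_le_of_ne h2 hh
    nlinarith
  exact hne (plane_unique (hW _ hvn.1) (hW _ ha.1) (hW _ hb.1) hav hbv hab
    hvn.2 h3 h4 hvm.2 ha.2 hb.2)

def IsMid (W : Finset (Euc 3)) (h n v : Euc 3) : Prop :=
  v ∈ face W n ∧ (∃ a ∈ face W n, ⟪h, a⟫ < ⟪h, v⟫) ∧ ∃ b ∈ face W n, ⟪h, v⟫ < ⟪h, b⟫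

lemma mid_le_two {W : Finset (Euc 3)} (hW : Sph W) (h v : Euc 3) :
    ((facets W).filter fun n => IsMid W h n v).card ≤ 2 := by
  by_contra hcon
  push Not at hcon
  obtain ⟨n₁, n₂, n₃, m1, m2, m3, n12, n13, n23⟩ := Finset.two_lt_card_iff.mp hcon
  simp only [Finset.mem_filter, mem_facets hW] at m1 m2 m3
  obtain ⟨f1, v1, ⟨a1, ha1, la1⟩, b1, hb1, lb1⟩ := m1
  obtain ⟨f2, v2, ⟨a2, ha2, la2⟩, b2, hb2, lb2⟩ := m2
  obtain ⟨f3, v3, ⟨a3, ha3, la3⟩, b3, hb3, lb3⟩ := m3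
  have h0 : h ≠ 0 := by
    rintro rfl; simp at la1
  have key : ∀ {a b : Euc 3}, ⟪h, a⟫ < ⟪h, v⟫ → ⟪h, v⟫ < ⟪h, b⟫ → a ≠ v ∧ b ≠ v ∧ a ≠ b := by
    intro a b h1 h2
    refine ⟨?_, ?_, ?_⟩ <;> (rintro rfl; linarith)
  have perp : ∀ a b : Euc 3,
      ⟪h, (⟪h, b⟫ - ⟪h, v⟫) • (a - v) + (⟪h, v⟫ - ⟪h, a⟫) • (b - v)⟫ = 0 := by
    intro a b
    simp only [inner_add_right, inner_smul_right, inner_sub_right]; ring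
  have zer : ∀ {n a b : Euc 3} (s t : ℝ), v ∈ face W n → a ∈ face W n → b ∈ face W n →
      ⟪n, s • (a - v) + t • (b - v)⟫ = 0 := by
    intro n a b s t hv ha hb
    rw [mem_face] at *
    simp only [inner_add_right, inner_smul_right, inner_sub_right, hv.2, ha.2, hb.2]; ring
  have lt : ∀ {n m a b : Euc 3}, Feas W n → n ≠ m → v ∈ face W n → v ∈ face W m →
      a ∈ face W m → b ∈ face W m → ⟪h, a⟫ < ⟪h, v⟫ → ⟪h, v⟫ < ⟪h, b⟫ →
      ⟪n, (⟪h, b⟫ - ⟪h, v⟫) • (a - v) + (⟪h, v⟫ - ⟪h, a⟫) • (b - v)⟫ < 0 := by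
    intro n m a b hn hne hvn hvm ha hb la lb
    obtain ⟨k1, k2, k3⟩ := key la lb
    exact ray_neg hW hn hne hvn hvm ha hb k1 k2 k3 (by linarith) (by linarith)
  exact three_rays h0 (perp a1 b1) (perp a2 b2) (perp a3 b3)
    (zer _ _ v1 ha1 hb1) (zer _ _ v2 ha2 hb2) (zer _ _ v3 ha3 hb3)
    (lt f1.1 n12 v1 v2 ha2 hb2 la2 lb2) (lt f1.1 n13 v1 v3 ha3 hb3 la3 lb3)
    (lt f2.1 n12.symm v2 v1 ha1 hb1 la1 lb1) (lt f2.1 n23 v2 v3 ha3 hb3 la3 lb3)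
    (lt f3.1 n13.symm v3 v1 ha1 hb1 la1 lb1) (lt f3.1 n23.symm v3 v2 ha2 hb2 la2 lb2)

/-- Number of middle vertices of a facet. -/
lemma card_mid {W : Finset (Euc 3)} {h n : Euc 3}
    (hh : ∀ x ∈ W, ∀ y ∈ W, ⟪h, x⟫ = ⟪h, y⟫ → x = y) (hn : (face W n).Nonempty) :
    (face W n).card ≤ (W.filter fun v => IsMid W h n v).card + 2 := by
  obtain ⟨a, ha, hamax⟩ := Finset.exists_max_image (face W n) (fun x => ⟪h, x⟫) hn
  obtain ⟨b, hb, hbmin⟩ := Finset.exists_min_image (face W n) (fun x => ⟪h, x⟫) hn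
  have hsub : face W n ⊆ (W.filter fun v => IsMid W h n v) ∪ {a, b} := by
    intro v hv
    simp only [Finset.mem_union, Finset.mem_filter, Finset.mem_insert, Finset.mem_singleton]
    by_cases h1 : v = a
    · right; left; exact h1
    by_cases h2 : v = b
    · right; right; exact h2
    left
    have hvW := (mem_face.mp hv).1
    refine ⟨hvW, hv, ⟨b, hb, ?_⟩, a, ha, ?_⟩
    · exact lt_of_le_of_ne (hbmin v hv) (fun e => h2 (hh _ (mem_face.mp hb).1 _ hvW e).symm)
    · exact lt_of_le_of_ne (hamax v hv) (fun e => h1 (hh _ hvW _ (mem_face.mp ha).1 e))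
  calc _ ≤ _ := Finset.card_le_card hsub
    _ ≤ _ := Finset.card_union_le _ _
    _ ≤ _ := by gcongr; exact Finset.card_le_two

/-- `∑ (k_f - 2) ≤ 2 (m - 2)`. -/
lemma sum_facets {W : Finset (Euc 3)} (hW : Sph W) (h2 : 2 ≤ W.card) :
    ∑ n ∈ facets W, ((face W n).card - 2) + 4 ≤ 2 * W.card := by
  obtain ⟨h, hh⟩ := exists_generic W
  have hne : W.Nonempty := Finset.card_pos.mp (by omega)
  obtain ⟨a, ha, hamax⟩ := Finset.exists_max_image W (fun x => ⟪h, x⟫) hne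
  obtain ⟨b, hb, hbmin⟩ := Finset.exists_min_image W (fun x => ⟪h, x⟫) hne
  have hab : a ≠ b := by
    rintro rfl
    obtain ⟨x, hx, y, hy, hxy⟩ := Finset.one_lt_card.mp (by omega : 1 < W.card)
    apply hxy
    apply hh x hx y hy
    linarith [hamax x hx, hamax y hy, hbmin x hx, hbmin y hy]
  have s1 : ∑ n ∈ facets W, ((face W n).card - 2) ≤
      ∑ n ∈ facets W, (W.filter fun v => IsMid W h n v).card := by
    apply Finset.sum_le_sum
    intro n hn
    rw [mem_facets hW] at hn
    have := card_mid (W := W) (h := h) (n := n) hh (Finset.card_pos.mp (by have := hn.2; omega))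
    omega
  have s2 : ∑ n ∈ facets W, (W.filter fun v => IsMid W h n v).card =
      ∑ v ∈ W, ((facets W).filter fun n => IsMid W h n v).card := by
    simp only [Finset.card_filter]
    exact Finset.sum_comm
  have s3 : ∑ v ∈ W, ((facets W).filter fun n => IsMid W h n v).card =
      ∑ v ∈ (W.erase a).erase b, ((facets W).filter fun n => IsMid W h n v).card := by
    symm
    apply Finset.sum_subset
    · intro x hx; simp at hx; exact hx.2.2
    · intro x hx hx'
      simp only [Finset.mem_erase, not_and, ne_eq] at hx'
      rw [Finset.card_eq_zero, Finset.filter_eq_empty_iff]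
      rintro n hn ⟨hxn, ⟨c, hc, lc⟩, d, hd, ld⟩
      have hc' := (mem_face.mp hc).1
      have hd' := (mem_face.mp hd).1
      by_cases e : x = b
      · subst e; linarith [hbmin c hc']
      · by_cases e' : x = a
        · subst e'; linarith [hamax d hd']
        · exact hx' e e' hx
  have s4 : ∑ v ∈ (W.erase a).erase b, ((facets W).filter fun n => IsMid W h n v).card ≤
      ((W.erase a).erase b).card * 2 := by
    apply Finset.sum_le_card_nsmul
    intro v _
    exact mid_le_two hW h v
  have s5 : ((W.erase a).erase b).card = W.card - 2 := by
    rw [Finset.card_erase_of_mem, Finset.card_erase_of_mem ha]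
    · omega
    · simp [hb, hab.symm]
  omega
/-! ## The Gabriel graph -/

def IsGab (W : Finset (Euc 3)) (u w : Euc 3) : Prop :=
  u ∈ W ∧ w ∈ W ∧ u ≠ w ∧ u ≠ -w ∧ ∀ x ∈ W, ⟪u + w, x⟫ ≤ 1 + ⟪u, w⟫

def Gab (W : Finset (Euc 3)) : Finset (Euc 3 × Euc 3) :=
  (W ×ˢ W).filter fun p => IsGab W p.1 p.2

lemma mem_Gab {W : Finset (Euc 3)} {u w : Euc 3} : (u, w) ∈ Gab W ↔ IsGab W u w := by
  simp only [Gab, Finset.mem_filter, Finset.mem_product]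
  constructor
  · exact fun h => h.2
  · exact fun h => ⟨⟨h.1, h.2.1⟩, h⟩

lemma IsGab.symm {W : Finset (Euc 3)} {u w : Euc 3} (h : IsGab W u w) : IsGab W w u := by
  obtain ⟨h1, h2, h3, h4, h5⟩ := h
  refine ⟨h2, h1, h3.symm, fun e => h4 (by rw [e, neg_neg]), fun x hx => ?_⟩
  rw [add_comm w u, real_inner_comm u w]
  exact h5 x hx

def nz (u w : Euc 3) : Euc 3 := (1 + ⟪u, w⟫)⁻¹ • (u + w)

lemma nz_symm (u w : Euc 3) : nz u w = nz w u := by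
  rw [nz, nz, real_inner_comm, add_comm u w]

lemma IsGab.pos {W : Finset (Euc 3)} (hW : Sph W) {u w : Euc 3} (h : IsGab W u w) :
    0 < 1 + ⟪u, w⟫ := by
  have := neg_one_lt_inner (hW _ h.1) (hW _ h.2.1) h.2.2.2.1
  linarith

lemma nz_inner (u w x : Euc 3) : ⟪nz u w, x⟫ = (1 + ⟪u, w⟫)⁻¹ * ⟪u + w, x⟫ := by
  rw [nz, inner_smul_left]; rfl

lemma IsGab.nz_left {W : Finset (Euc 3)} (hW : Sph W) {u w : Euc 3} (h : IsGab W u w) :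
    ⟪nz u w, u⟫ = 1 := by
  have := h.pos hW
  rw [nz_inner, inner_add_left, self_one (hW _ h.1), real_inner_comm u w]
  field_simp

lemma IsGab.nz_right {W : Finset (Euc 3)} (hW : Sph W) {u w : Euc 3} (h : IsGab W u w) :
    ⟪nz u w, w⟫ = 1 := by
  rw [nz_symm]; exact h.symm.nz_left hW

lemma IsGab.nz_feas {W : Finset (Euc 3)} (hW : Sph W) {u w : Euc 3} (h : IsGab W u w) :
    Feas W (nz u w) := by
  intro x hx
  have := h.pos hW
  rw [nz_inner, inv_mul_le_iff₀ this, mul_one]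
  exact h.2.2.2.2 x hx

lemma IsGab.inner_eq {W : Finset (Euc 3)} (hW : Sph W) {u w x : Euc 3} (h : IsGab W u w)
    (hx : ⟪nz u w, x⟫ = 1) : ⟪u + w, x⟫ = 1 + ⟪u, w⟫ := by
  have := h.pos hW
  rw [nz_inner] at hx
  field_simp at hx
  exact hx

def IsDiag (W : Finset (Euc 3)) (u w : Euc 3) : Prop :=
  (∃ x ∈ face W (nz u w), 0 < ⟪cr u w, x⟫) ∧ ∃ x ∈ face W (nz u w), ⟪cr u w, x⟫ < 0

lemma IsDiag.symm {W : Finset (Euc 3)} {u w : Euc 3} (h : IsDiag W u w) : IsDiag W w u := by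
  obtain ⟨⟨x, hx, hx'⟩, y, hy, hy'⟩ := h
  rw [IsDiag, nz_symm w u]
  rw [cr_swap] at hx' hy'
  exact ⟨⟨y, hy, by linarith⟩, x, hx, by linarith⟩

/-- non-coplanarity together with central symmetry -/
def Full (W : Finset (Euc 3)) : Prop := ∀ c : Euc 3, c ≠ 0 → ∃ x ∈ W, 0 < ⟪c, x⟫

def IsSideOf (W : Finset (Euc 3)) (n u w : Euc 3) : Prop :=
  u ∈ face W n ∧ w ∈ face W n ∧ u ≠ w ∧ u ≠ -w ∧ ∀ y ∈ face W n, 0 ≤ ⟪cr u w, y⟫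

lemma exists_side {W : Finset (Euc 3)} (hW : Sph W) (hF : Full W) {u w : Euc 3}
    (h : IsGab W u w) (hd : ¬ IsDiag W u w) : ∃ n ∈ facets W, IsSideOf W n u w := by
  have hc := cr_ne_zero (hW _ h.1) (hW _ h.2.1) h.2.2.1 h.2.2.2.1
  obtain ⟨x0, hx0, hx0'⟩ := hF _ hc
  obtain ⟨x, hx, hmin⟩ := Finset.exists_min_image (W.filter fun x => 0 < ⟪cr u w, x⟫)
    (fun x => (1 - ⟪nz u w, x⟫) / ⟪cr u w, x⟫) ⟨x0, by simp [hx0, hx0']⟩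
  simp only [Finset.mem_filter] at hx hmin
  obtain ⟨hxW, hxc⟩ := hx
  set t := (1 - ⟪nz u w, x⟫) / ⟪cr u w, x⟫ with ht
  have hf := h.nz_feas hW
  have t0 : 0 ≤ t := div_nonneg (by linarith [hf x hxW]) hxc.le
  have hin : ∀ y, ⟪nz u w + t • cr u w, y⟫ = ⟪nz u w, y⟫ + t * ⟪cr u w, y⟫ := by
    intro y; rw [inner_add_left, inner_smul_left]; rfl
  have hfe : Feas W (nz u w + t • cr u w) := by
    intro y hy
    rw [hin]
    rcases le_or_gt ⟪cr u w, y⟫ 0 with h1 | h1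
    · nlinarith [hf y hy]
    · have := hmin y ⟨hy, h1⟩
      rw [le_div_iff₀ h1] at this
      linarith
  have hxf : x ∈ face W (nz u w + t • cr u w) := by
    rw [mem_face, hin]
    refine ⟨hxW, ?_⟩
    rw [ht, div_mul_cancel₀ _ hxc.ne']; ring
  have huf : u ∈ face W (nz u w + t • cr u w) := by
    rw [mem_face, hin, cr_left, h.nz_left hW]; exact ⟨h.1, by ring⟩
  have hwf : w ∈ face W (nz u w + t • cr u w) := by
    rw [mem_face, hin, cr_right, h.nz_right hW]; exact ⟨h.2.1, by ring⟩
  refine ⟨nz u w + t • cr u w, ?_, huf, hwf, h.2.2.1, h.2.2.2.1, ?_⟩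
  · rw [mem_facets hW]
    refine ⟨hfe, ?_⟩
    have : 2 < (face W (nz u w + t • cr u w)).card := by
      rw [Finset.two_lt_card_iff]
      refine ⟨u, w, x, huf, hwf, hxf, h.2.2.1, ?_, ?_⟩
      · rintro rfl; rw [cr_left] at hxc; exact lt_irrefl _ hxc
      · rintro rfl; rw [cr_right] at hxc; exact lt_irrefl _ hxc
    exact this
  · intro y hy
    by_contra hneg
    push Not at hneg
    rcases t0.eq_or_lt with h0 | h0
    · rw [← h0, zero_smul, add_zero] at hy hxf
      exact hd ⟨⟨x, hxf, hxc⟩, y, hy, hneg⟩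
    · rw [mem_face, hin] at hy
      nlinarith [hf y hy.1, hy.2, mul_neg_of_pos_of_neg h0 hneg]

def sides (W : Finset (Euc 3)) (n : Euc 3) : Finset (Euc 3 × Euc 3) :=
  (W ×ˢ W).filter fun p => IsSideOf W n p.1 p.2

lemma card_sides {W : Finset (Euc 3)} (hW : Sph W) (n : Euc 3) :
    (sides W n).card ≤ (face W n).card := by
  apply Finset.card_le_card_of_injOn Prod.fst
  · rintro ⟨u, w⟩ h
    simp only [sides, Finset.coe_filter, Set.mem_ofPred_eq] at h
    exact h.2.1
  · rintro ⟨u, w⟩ h ⟨u', w'⟩ h' he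
    simp only [sides, Finset.coe_filter, Set.mem_ofPred_eq] at h h' he
    subst he
    obtain ⟨-, hu, hw, huw, huw', hy⟩ := h
    obtain ⟨-, -, hw', hu2, hu2', hy'⟩ := h'
    by_contra hne
    have hne' : w ≠ w' := fun e => hne (by rw [e])
    have h1 := hy w' hw'
    have h2 := hy' w hw
    rw [cr_swap'] at h2
    have h3 : ⟪cr u w, w'⟫ = 0 := by linarith
    rw [mem_face] at hu hw hw'
    have hc := cr_ne_zero (hW _ hu.1) (hW _ hw.1) huw huw'
    have : n = n + cr u w := plane_unique (hW _ hu.1) (hW _ hw.1) (hW _ hw'.1) huw.symm hu2.symm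
      hne' hu.2 hw.2 hw'.2 (by rw [inner_add_left, cr_left, hu.2, add_zero])
      (by rw [inner_add_left, cr_right, hw.2, add_zero])
      (by rw [inner_add_left, h3, hw'.2, add_zero])
    exact hc (by simpa using this)

def diags (W : Finset (Euc 3)) (n : Euc 3) : Finset (Euc 3 × Euc 3) :=
  (Gab W).filter fun p => IsDiag W p.1 p.2 ∧ nz p.1 p.2 = n

lemma mem_diags {W : Finset (Euc 3)} {n u w : Euc 3} :
    (u, w) ∈ diags W n ↔ IsGab W u w ∧ IsDiag W u w ∧ nz u w = n := by
  simp [diags, mem_Gab]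

lemma partner_unique {W : Finset (Euc 3)} (hW : Sph W) {u w w' : Euc 3} (h : IsGab W u w)
    (h' : IsGab W u w') (he : nz u w = nz u w') : w = w' := by
  have p := h.pos hW
  have p' := h'.pos hW
  have q := h.inner_eq hW (x := w') (by rw [he]; exact h'.nz_right hW)
  have q' := h'.inner_eq hW (x := w) (by rw [← he]; exact h.nz_right hW)
  rw [inner_add_left] at q q'
  rw [real_inner_comm w w'] at q'
  have e : ⟪u, w⟫ = ⟪u, w'⟫ := by linarith
  rw [nz, nz, e] at he
  have := smul_right_injective (Euc 3) (inv_ne_zero p'.ne') he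
  simpa using this

lemma card_diags {W : Finset (Euc 3)} (hW : Sph W) (n : Euc 3) :
    (diags W n).card ≤ (face W n).card ∧
    (((diags W n).card = (face W n).card) → ∀ u ∈ face W n, ∃ w, (u, w) ∈ diags W n) := by
  have hinj : Set.InjOn Prod.fst (diags W n : Set (Euc 3 × Euc 3)) := by
    rintro ⟨u, w⟩ h ⟨u', w'⟩ h' he
    simp only [Finset.mem_coe, mem_diags] at h h' he
    subst he
    rw [partner_unique hW h.1 h'.1 (by rw [h.2.2, h'.2.2])]
  have hmaps : (diags W n).image Prod.fst ⊆ face W n := by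
    intro u hu
    simp only [Finset.mem_image, Prod.exists, exists_and_right, exists_eq_right] at hu
    obtain ⟨w, h⟩ := hu
    rw [mem_diags] at h
    rw [mem_face, ← h.2.2]
    exact ⟨h.1.1, h.1.nz_left hW⟩
  have hcard : ((diags W n).image Prod.fst).card = (diags W n).card :=
    Finset.card_image_of_injOn hinj
  refine ⟨hcard ▸ Finset.card_le_card hmaps, fun he u hu => ?_⟩
  rw [← Finset.eq_of_subset_of_card_le hmaps (by omega)] at hu
  simpa only [Finset.mem_image, Prod.exists, exists_and_right, exists_eq_right] using hu

lemma even_diags (W : Finset (Euc 3)) (n : Euc 3) : Even (diags W n).card := by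
  have h := Finset.sum_involution (s := diags W n) (f := fun _ => (1 : ZMod 2))
    (fun p _ => p.swap) (by intros; decide)
    (by
      rintro ⟨u, w⟩ h _ he
      rw [mem_diags] at h
      simp only [Prod.swap_prod_mk, Prod.mk.injEq] at he
      exact h.1.2.2.1 he.2)
    (by
      rintro ⟨u, w⟩ h
      rw [Prod.swap_prod_mk]
      rw [mem_diags] at h ⊢
      exact ⟨h.1.symm, h.2.1.symm, by rw [nz_symm]; exact h.2.2⟩)
    (by rintro ⟨u, w⟩ h; rfl)
  simp only [Finset.sum_const, nsmul_eq_mul, mul_one] at h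
  exact (ZMod.natCast_eq_zero_iff_even).mp h

lemma diags_small {W : Finset (Euc 3)} (hW : Sph W) {n : Euc 3} (h : (diags W n).Nonempty) :
    n ∈ facets W ∧ 4 ≤ (face W n).card := by
  obtain ⟨⟨u, w⟩, h⟩ := h
  rw [mem_diags] at h
  obtain ⟨hg, ⟨⟨x, hx, hx'⟩, y, hy, hy'⟩, rfl⟩ := h
  have hu : u ∈ face W (nz u w) := mem_face.mpr ⟨hg.1, hg.nz_left hW⟩
  have hw : w ∈ face W (nz u w) := mem_face.mpr ⟨hg.2.1, hg.nz_right hW⟩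
  have c4 : 4 ≤ (face W (nz u w)).card := by
    have hs : ({u, w, x, y} : Finset (Euc 3)) ⊆ face W (nz u w) := by
      intro z hz
      simp only [Finset.mem_insert, Finset.mem_singleton] at hz
      rcases hz with rfl | rfl | rfl | rfl <;> assumption
    have hc : ({u, w, x, y} : Finset (Euc 3)).card = 4 := by
      have l := cr_left u w
      have r := cr_right u w
      have a1 : u ≠ x := by rintro rfl; linarith
      have a2 : w ≠ x := by rintro rfl; linarith
      have a3 : u ≠ y := by rintro rfl; linarith
      have a4 : w ≠ y := by rintro rfl; linarith
      have a5 : x ≠ y := by rintro rfl; linarith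
      have a6 := hg.2.2.1
      rw [Finset.card_insert_of_notMem, Finset.card_insert_of_notMem, Finset.card_pair a5] <;>
        simp [*]
    rw [← hc]; exact Finset.card_le_card hs
  refine ⟨?_, c4⟩
  rw [mem_facets hW]
  exact ⟨hg.nz_feas hW, by omega⟩

def IsRect (W : Finset (Euc 3)) (n : Euc 3) : Prop :=
  (face W n).card = 4 ∧ (diags W n).card = 4

lemma facet_bound {W : Finset (Euc 3)} (hW : Sph W) {n : Euc 3} (hn : n ∈ facets W) :
    (sides W n).card + (diags W n).card ≤
      3 * ((face W n).card - 2) + if IsRect W n then 2 else 0 := by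
  have h1 := card_sides hW n
  have h2 := (card_diags hW n).1
  obtain ⟨e, he⟩ := even_diags W n
  have h3 : 3 ≤ (face W n).card := ((mem_facets hW).mp hn).2
  have h4 : (diags W n).card = 0 ∨ 4 ≤ (face W n).card := by
    by_cases h : (diags W n).Nonempty
    · exact Or.inr (diags_small hW h).2
    · left; simpa using h
  split_ifs with hr
  · have := hr.1; have := hr.2; omega
  · rw [IsRect] at hr
    omega

lemma card_Gab_le {W : Finset (Euc 3)} (hW : Sph W) (hF : Full W) :
    (Gab W).card ≤ ∑ n ∈ facets W, ((sides W n).card + (diags W n).card) := by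
  have hsub : Gab W ⊆ (facets W).biUnion fun n => sides W n ∪ diags W n := by
    rintro ⟨u, w⟩ h
    simp only [Finset.mem_biUnion, Finset.mem_union]
    have hg := mem_Gab.mp h
    by_cases hd : IsDiag W u w
    · have hm : (u, w) ∈ diags W (nz u w) := mem_diags.mpr ⟨hg, hd, rfl⟩
      exact ⟨nz u w, (diags_small hW ⟨_, hm⟩).1, Or.inr hm⟩
    · obtain ⟨n, hn, hs⟩ := exists_side hW hF hg hd
      refine ⟨n, hn, Or.inl ?_⟩
      simp only [sides, Finset.mem_filter, Finset.mem_product]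
      exact ⟨⟨hg.1, hg.2.1⟩, hs⟩
  calc _ ≤ _ := Finset.card_le_card hsub
    _ ≤ _ := Finset.card_biUnion_le
    _ ≤ _ := Finset.sum_le_sum fun n _ => Finset.card_union_le _ _
/-! ## At most three rectangles at each vertex -/

lemma ray_unique {W : Finset (Euc 3)} (hW : Sph W) {n m v r z a b : Euc 3} (hn : Feas W n)
    (hvn : v ∈ face W n) (hvm : v ∈ face W m) (ha : a ∈ face W m) (hb : b ∈ face W m)
    (hav : a ≠ v) (hbv : b ≠ v) (hab : a ≠ b) {s t l l' : ℝ} (hs : 0 < s) (ht : 0 < t)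
    (hz : z = r + l • v) (h1 : ⟪n, z⟫ = 0) (h2 : ⟪m, z⟫ ≤ 0)
    (hz' : s • (a - v) + t • (b - v) = r + l' • v) : n = m ∧ l = l' := by
  have nv := (mem_face.mp hvn).2
  have mv := (mem_face.mp hvm).2
  have na := hn a (mem_face.mp ha).1
  have nb := hn b (mem_face.mp hb).1
  have ma := (mem_face.mp ha).2
  have mb := (mem_face.mp hb).2
  have e1 := congrArg (fun z => ⟪n, z⟫) hz'
  have e2 := congrArg (fun z => ⟪m, z⟫) hz'
  simp only [inner_add_right, inner_smul_right, inner_sub_right, nv, mv, ma, mb] at e1 e2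
  simp only [hz, inner_add_right, inner_smul_right, nv, mv] at h1 h2
  have hl : l = l' := by
    apply le_antisymm
    · linarith
    · nlinarith
  refine ⟨?_, hl⟩
  by_contra hne
  have := ray_neg hW hn hne hvn hvm ha hb hav hbv hab hs ht
  simp only [inner_add_right, inner_smul_right, inner_sub_right, nv] at this
  subst hl
  linarith

lemma rect_pts {W : Finset (Euc 3)} (hW : Sph W) {n v : Euc 3} (hr : IsRect W n)
    (hv : v ∈ face W n) : ∃ p q, p ∈ face W n ∧ q ∈ face W n ∧ p ≠ v ∧ q ≠ v ∧ p ≠ q ∧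
      ⟪p - v, q - v⟫ = 0 := by
  have hall := (card_diags hW n).2 (by rw [hr.1, hr.2])
  obtain ⟨v', hv'⟩ := hall v hv
  rw [mem_diags] at hv'
  have : ∃ p ∈ face W n, p ∉ ({v, v'} : Finset (Euc 3)) := by
    apply Finset.exists_mem_notMem_of_card_lt_card
    rw [hr.1]
    exact lt_of_le_of_lt Finset.card_le_two (by norm_num)
  obtain ⟨p, hp, hpv⟩ := this
  simp only [Finset.mem_insert, Finset.mem_singleton, not_or] at hpv
  obtain ⟨q, hq⟩ := hall p hp
  rw [mem_diags] at hq
  obtain ⟨hg, -, hn⟩ := hq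
  have hqv : q ≠ v := by
    rintro rfl
    exact hpv.2 (partner_unique hW hg.symm hv'.1 (by rw [nz_symm, hn, hv'.2.2]))
  refine ⟨p, q, hp, ?_, hpv.1, hqv, hg.2.2.1, ?_⟩
  · rw [mem_face, ← hn]; exact ⟨hg.2.1, hg.nz_right hW⟩
  · rw [mem_face] at hv
    have := hg.inner_eq hW (x := v) (by rw [hn]; exact hv.2)
    rw [inner_add_left] at this
    simp only [inner_sub_left, inner_sub_right, self_one (hW _ hv.1)]
    rw [real_inner_comm q v]
    linarith

lemma decomp {v x : Euc 3} (hv : ⟪v, v⟫ = 1) (hx : ⟪x, x⟫ = 1) (hvx : ⟪v, x⟫ = 0) (z : Euc 3) :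
    z = ⟪z, x⟫ • x + ⟪z, cr v x⟫ • cr v x + ⟪z, v⟫ • v := by
  have hy : ⟪cr v x, cr v x⟫ = 1 := by rw [cr_self, hv, hx, hvx]; norm_num
  have yv := cr_left v x
  have yx := cr_right v x
  have hxv : ⟪x, v⟫ = 0 := by rw [real_inner_comm]; exact hvx
  have vy : ⟪v, cr v x⟫ = 0 := by rw [real_inner_comm]; exact yv
  have xy : ⟪x, cr v x⟫ = 0 := by rw [real_inner_comm]; exact yx
  generalize cr v x = y at *
  rw [← sub_eq_zero]
  by_contra hne
  obtain ⟨α, β, γ, h0, hr⟩ := exists_rel_of_perp (a := v) (b := x) (c := y) hne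
    (by simp only [inner_sub_left, inner_add_left, inner_smul_left, hv, hxv, yv, conj_trivial]; ring)
    (by simp only [inner_sub_left, inner_add_left, inner_smul_left, hx, hvx, yx, conj_trivial]; ring)
    (by simp only [inner_sub_left, inner_add_left, inner_smul_left, hy, vy, xy, conj_trivial]; ring)
  apply h0
  have q1 := congrArg (fun z => ⟪v, z⟫) hr
  have q2 := congrArg (fun z => ⟪x, z⟫) hr
  have q3 := congrArg (fun z => ⟪y, z⟫) hr
  simp only [inner_add_right, inner_smul_right, hv, hx, hy, hvx, hxv, yv, yx, vy, xy,
    inner_zero_right] at q1 q2 q3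
  exact ⟨by linarith, by linarith, by linarith⟩

lemma scale_ray {a b x v : Euc 3} {α β γ l : ℝ} (hα : 0 < α) (hβ : 0 < β) (hγ : γ ≠ 0)
    (h : α • a + β • b = γ • x + l • v) :
    ∃ r, (r = x ∨ r = -x) ∧ ∃ s t l' : ℝ, 0 < s ∧ 0 < t ∧ s • a + t • b = r + l' • v := by
  have hd : α • a = γ • x + l • v - β • b := by rw [← h]; simp
  rcases lt_or_gt_of_ne hγ with h1 | h1
  · refine ⟨-x, Or.inr rfl, (-γ)⁻¹ * α, (-γ)⁻¹ * β, (-γ)⁻¹ * l, ?_, ?_, ?_⟩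
    · have : 0 < -γ := by linarith
      positivity
    · have : 0 < -γ := by linarith
      positivity
    · rw [mul_smul, hd]
      match_scalars <;> (field_simp; try ring)
  · refine ⟨x, Or.inl rfl, γ⁻¹ * α, γ⁻¹ * β, γ⁻¹ * l, by positivity, by positivity, ?_⟩
    rw [mul_smul, hd]
    match_scalars <;> (field_simp; try ring)

lemma two_dim {P Q S T : ℝ} (h : P * S + Q * T < 0) :
    (∃ α β : ℝ, 0 < α ∧ 0 < β ∧ α * Q + β * T = 0) ∨
    (∃ α β : ℝ, 0 < α ∧ 0 < β ∧ α * P + β * S = 0) := by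
  have key : ∀ A B : ℝ, A * B < 0 → ∃ α β : ℝ, 0 < α ∧ 0 < β ∧ α * A + β * B = 0 := by
    intro A B hAB
    rcases mul_neg_iff.mp hAB with ⟨h1, h2⟩ | ⟨h1, h2⟩
    · exact ⟨-B, A, by linarith, h1, by ring⟩
    · exact ⟨B, -A, h2, by linarith, by ring⟩
  by_cases h1 : Q * T < 0
  · exact Or.inl (key _ _ h1)
  · exact Or.inr (key _ _ (by linarith))

lemma sector {v x a b n : Euc 3} (hv : ⟪v, v⟫ = 1) (hx : ⟪x, x⟫ = 1) (hvx : ⟪v, x⟫ = 0)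
    (hab : ⟪a, b⟫ = 0) (hav : ⟪a, v⟫ < 0) (hbv : ⟪b, v⟫ < 0)
    (hna : ⟪n, a⟫ = 0) (hnb : ⟪n, b⟫ = 0) (hnv : ⟪n, v⟫ = 1) :
    ∃ r, (r = x ∨ r = -x ∨ r = cr v x ∨ r = - cr v x) ∧
      ∃ s t l : ℝ, 0 < s ∧ 0 < t ∧ s • a + t • b = r + l • v := by
  have hd := decomp hv hx hvx
  have hyy : cr v x = cr v x := rfl
  have h2 : ⟪a, x⟫ * ⟪b, x⟫ + ⟪a, cr v x⟫ * ⟪b, cr v x⟫ < 0 := by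
    have e := hab
    rw [hd b] at e
    simp only [inner_add_right, inner_smul_right] at e
    nlinarith [mul_pos_of_neg_of_neg hav hbv]
  have hzv : ∀ α β : ℝ, 0 < α → 0 < β → ∀ c : ℝ, α • a + β • b = c • v → False := by
    intro α β hα hβ c hc
    have e1 := congrArg (fun z => ⟪n, z⟫) hc
    have e2 := congrArg (fun z => ⟪z, v⟫) hc
    simp only [inner_add_right, inner_smul_right, hna, hnb, hnv] at e1
    simp only [inner_add_left, inner_smul_left, hv, conj_trivial] at e2
    nlinarith [mul_neg_of_pos_of_neg hα hav, mul_neg_of_pos_of_neg hβ hbv]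
  rcases two_dim h2 with ⟨α, β, hα, hβ, h0⟩ | ⟨α, β, hα, hβ, h0⟩
  · have hz := hd (α • a + β • b)
    have : ⟪α • a + β • b, cr v x⟫ = 0 := by
      simp only [inner_add_left, inner_smul_left, conj_trivial]; exact h0
    rw [this, zero_smul, add_zero] at hz
    by_cases hγ : ⟪α • a + β • b, x⟫ = 0
    · rw [hγ, zero_smul, zero_add] at hz
      exact (hzv α β hα hβ _ hz).elim
    · obtain ⟨r, hr, hh⟩ := scale_ray hα hβ hγ hz
      exact ⟨r, by tauto, hh⟩
  · have hz := hd (α • a + β • b)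
    have : ⟪α • a + β • b, x⟫ = 0 := by
      simp only [inner_add_left, inner_smul_left, conj_trivial]; exact h0
    rw [this, zero_smul, zero_add] at hz
    by_cases hγ : ⟪α • a + β • b, cr v x⟫ = 0
    · rw [hγ, zero_smul, zero_add] at hz
      exact (hzv α β hα hβ _ hz).elim
    · obtain ⟨r, hr, hh⟩ := scale_ray hα hβ hγ hz
      exact ⟨r, by tauto, hh⟩

lemma rect_le_three {W : Finset (Euc 3)} (hW : Sph W) {v : Euc 3} (hvW : v ∈ W) :
    ((facets W).filter fun n => IsRect W n ∧ v ∈ face W n).card ≤ 3 := by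
  set R := (facets W).filter fun n => IsRect W n ∧ v ∈ face W n with hR
  rcases R.eq_empty_or_nonempty with h0 | ⟨n₁, hn₁⟩
  · rw [h0]; simp
  have hmem : ∀ n ∈ R, Feas W n ∧ IsRect W n ∧ v ∈ face W n := by
    intro n hn
    rw [hR, Finset.mem_filter, mem_facets hW] at hn
    exact ⟨hn.1.1, hn.2⟩
  have hpts : ∀ n, ∃ p q, n ∈ R → (p ∈ face W n ∧ q ∈ face W n ∧ p ≠ v ∧ q ≠ v ∧ p ≠ q ∧
      ⟪p - v, q - v⟫ = 0) := by
    intro n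
    by_cases hn : n ∈ R
    · obtain ⟨p, q, h⟩ := rect_pts hW (hmem n hn).2.1 (hmem n hn).2.2
      exact ⟨p, q, fun _ => h⟩
    · exact ⟨0, 0, fun h => absurd h hn⟩
  choose p q hpq using hpts
  have hv1 : ⟪v, v⟫ = 1 := self_one (hW v hvW)
  have hneg : ∀ n, ∀ y ∈ face W n, y ≠ v → ⟪y - v, v⟫ < 0 := by
    intro n y hy hyv
    have := inner_lt_one' (hW _ (mem_face.mp hy).1) (hW v hvW) hyv
    rw [inner_sub_left, hv1]; linarith
  -- first axis
  obtain ⟨k1, k2, k3, k4, k5, k6⟩ := hpq n₁ hn₁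
  set x' : Euc 3 := (p n₁ - v) - ⟪p n₁ - v, v⟫ • v with hx'
  have nv1 := (mem_face.mp (hmem n₁ hn₁).2.2).2
  have np1 := (mem_face.mp k1).2
  have x'0 : x' ≠ 0 := by
    intro h
    have e := congrArg (fun z => ⟪n₁, z⟫) h
    simp only [hx', inner_sub_right, inner_smul_right, nv1, np1, inner_zero_right] at e
    have := hneg n₁ _ k1 k3
    linarith
  have hvx' : ⟪v, x'⟫ = 0 := by
    rw [hx', inner_sub_right, inner_smul_right, hv1, real_inner_comm v]; ring
  have hnx : 0 < ‖x'‖ := norm_pos_iff.mpr x'0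
  set x : Euc 3 := ‖x'‖⁻¹ • x' with hx
  have hxx : ⟪x, x⟫ = 1 := by
    apply self_one
    rw [hx, norm_smul, norm_inv, norm_norm, inv_mul_cancel₀ hnx.ne']
  have hvx : ⟪v, x⟫ = 0 := by rw [hx, inner_smul_right, hvx', mul_zero]
  have hz : ‖x'‖⁻¹ • (p n₁ - v) = x + (‖x'‖⁻¹ * ⟪p n₁ - v, v⟫) • v := by
    rw [hx, hx']; module
  have hsec : ∀ n, ∃ r, n ∈ R → (r = x ∨ r = -x ∨ r = cr v x ∨ r = - cr v x) ∧
      ∃ s t l : ℝ, 0 < s ∧ 0 < t ∧ s • (p n - v) + t • (q n - v) = r + l • v := by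
    intro n
    by_cases hn : n ∈ R
    · obtain ⟨j1, j2, j3, j4, j5, j6⟩ := hpq n hn
      have nv := (mem_face.mp (hmem n hn).2.2).2
      obtain ⟨r, hr⟩ := sector (n := n) hv1 hxx hvx j6 (hneg n _ j1 j3) (hneg n _ j2 j4)
        (by rw [inner_sub_right, nv, (mem_face.mp j1).2, sub_self])
        (by rw [inner_sub_right, nv, (mem_face.mp j2).2, sub_self]) nv
      exact ⟨r, fun _ => hr⟩
    · exact ⟨0, fun h => absurd h hn⟩
  choose r hr using hsec
  have hle : R.card ≤ ({-x, cr v x, - cr v x} : Finset (Euc 3)).card := by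
    apply Finset.card_le_card_of_injOn r
    · intro n hn
      have hn : n ∈ R := hn
      obtain ⟨hrr, s, t, l, hs, ht, he⟩ := hr n hn
      obtain ⟨j1, j2, j3, j4, j5, j6⟩ := hpq n hn
      rcases hrr with h | h
      · exfalso
        rw [h] at he
        have hm := hmem n hn
        have hm1 := hmem n₁ hn₁
        obtain ⟨hnn, hll⟩ := ray_unique hW hm1.1 hm1.2.2 hm.2.2 j1 j2 j3 j4 j5 hs ht hz
          (by rw [inner_smul_right, inner_sub_right, np1, nv1]; ring)
          (by
            rw [inner_smul_right, inner_sub_right, (mem_face.mp hm.2.2).2]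
            have := hm.1 _ (mem_face.mp k1).1
            exact mul_nonpos_of_nonneg_of_nonpos (by positivity) (by linarith)) he
        subst hnn
        rw [hll] at hz
        have : (s - ‖x'‖⁻¹) • (p n₁ - v) + t • (q n₁ - v) = 0 := by
          rw [sub_smul, hz, ← he]; abel
        have := indep_sphere (hW v hvW) (hW _ (mem_face.mp k1).1) (hW _ (mem_face.mp k2).1)
          k3 k4 k5 this
        linarith [this.2]
      · simp only [Finset.coe_insert, Finset.coe_singleton, Set.mem_insert_iff,
          Set.mem_singleton_iff]
        exact h
    · intro n hn m hm he
      have hn : n ∈ R := hn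
      have hm : m ∈ R := hm
      obtain ⟨-, s, t, l, hs, ht, h1⟩ := hr n hn
      obtain ⟨-, s', t', l', hs', ht', h2⟩ := hr m hm
      obtain ⟨j1, j2, j3, j4, j5, j6⟩ := hpq n hn
      obtain ⟨i1, i2, i3, i4, i5, i6⟩ := hpq m hm
      have hn' := hmem n hn
      have hm' := hmem m hm
      rw [← he] at h2
      refine (ray_unique hW hn'.1 hn'.2.2 hm'.2.2 i1 i2 i3 i4 i5 hs' ht' h1 ?_ ?_ h2).1
      · simp only [inner_add_right, inner_smul_right, inner_sub_right, (mem_face.mp hn'.2.2).2,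
          (mem_face.mp j1).2, (mem_face.mp j2).2]; ring
      · simp only [inner_add_right, inner_smul_right, inner_sub_right, (mem_face.mp hm'.2.2).2]
        have a1 := hm'.1 _ (mem_face.mp j1).1
        have a2 := hm'.1 _ (mem_face.mp j2).1
        nlinarith
  exact hle.trans Finset.card_le_three

lemma card_rect {W : Finset (Euc 3)} (hW : Sph W) :
    4 * ((facets W).filter fun n => IsRect W n).card ≤ 3 * W.card := by
  have h1 : ∑ n ∈ (facets W).filter (fun n => IsRect W n), (face W n).card =
      4 * ((facets W).filter fun n => IsRect W n).card := by
    rw [Finset.sum_const_nat (m := 4)]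
    · ring
    · intro n hn
      rw [Finset.mem_filter] at hn
      exact hn.2.1
  have h2 : ∑ n ∈ (facets W).filter (fun n => IsRect W n), (face W n).card =
      ∑ v ∈ W, ((facets W).filter fun n => IsRect W n ∧ v ∈ face W n).card := by
    have hf : ∀ n, (face W n).card = ∑ v ∈ W, if v ∈ face W n then 1 else 0 := by
      intro n
      rw [← Finset.card_filter]
      congr 1
      ext z
      simp only [Finset.mem_filter, mem_face]
      tauto
    simp only [hf]
    rw [Finset.sum_comm]
    apply Finset.sum_congr rfl
    intro v hv
    rw [← Finset.filter_filter, Finset.card_filter]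
  have h3 := Finset.sum_le_card_nsmul W
    (fun v => ((facets W).filter fun n => IsRect W n ∧ v ∈ face W n).card) 3
    (fun v hv => rect_le_three hW hv)
  rw [smul_eq_mul] at h3
  omega

lemma full_bound {W : Finset (Euc 3)} (hW : Sph W) (hF : Full W) (h2 : 2 ≤ W.card) :
    2 * (Gab W).card + 24 ≤ 15 * W.card := by
  have h3 := (card_Gab_le hW hF).trans (Finset.sum_le_sum fun n hn => facet_bound hW hn)
  rw [Finset.sum_add_distrib, ← Finset.mul_sum, ← Finset.sum_filter] at h3
  rw [Finset.sum_const, smul_eq_mul] at h3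
  have h4 := sum_facets hW h2
  have h5 := card_rect hW
  omega
/-! ## The coplanar case -/

lemma circle_real {a b a' b' : ℝ} (h : a ^ 2 + b ^ 2 = 1) (h' : a' ^ 2 + b' ^ 2 = 1)
    (hb : 0 < b * b') (h1 : b * b' ≤ (1 - a') * (1 + a)) (h2 : b * b' ≤ (1 - a) * (1 + a')) :
    a = a' := by
  have hsq : (b * b') ^ 2 = ((1 - a') * (1 + a)) * ((1 - a) * (1 + a')) := by
    have e1 : b ^ 2 = 1 - a ^ 2 := by linarith
    have e2 : b' ^ 2 = 1 - a' ^ 2 := by linarith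
    rw [mul_pow, e1, e2]; ring
  have hKL : (1 - a') * (1 + a) = (1 - a) * (1 + a') := by
    generalize (1 - a') * (1 + a) = K at *
    generalize (1 - a) * (1 + a') = L at *
    rcases lt_trichotomy K L with h | h | h
    · nlinarith
    · exact h
    · nlinarith
  linarith

lemma coplanar_bound {W : Finset (Euc 3)} (hW : Sph W) {c : Euc 3} (hc : ⟪c, c⟫ = 1)
    (hcW : ∀ x ∈ W, ⟪c, x⟫ = 0) : (Gab W).card ≤ 2 * W.card := by
  have hle : (Gab W).card ≤ (W ×ˢ (Finset.univ : Finset Bool)).card := by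
    apply Finset.card_le_card_of_injOn (fun p => (p.1, decide (0 < ⟪p.2, cr p.1 c⟫)))
    · rintro ⟨u, w⟩ h
      have h : (u, w) ∈ Gab W := h
      rw [mem_Gab] at h
      exact Finset.mem_coe.mpr (Finset.mem_product.mpr ⟨h.1, Finset.mem_univ _⟩)
    · rintro ⟨u, w⟩ h ⟨u', w'⟩ h' he
      have h : (u, w) ∈ Gab W := h
      have h' : (u', w') ∈ Gab W := h'
      rw [mem_Gab] at h h'
      simp only [Prod.mk.injEq, decide_eq_decide] at he
      obtain ⟨rfl, he⟩ := he
      have hu1 := self_one (hW _ h.1)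
      have huc : ⟪u, c⟫ = 0 := by rw [real_inner_comm]; exact hcW _ h.1
      have hd : ∀ z ∈ W, z = ⟪z, cr u c⟫ • cr u c + ⟪z, u⟫ • u := by
        intro z hz
        have := decomp hu1 hc huc z
        rw [real_inner_comm c z, hcW z hz, zero_smul, zero_add] at this
        exact this
      have hin : ∀ z ∈ W, ∀ y, ⟪y, z⟫ = ⟪z, cr u c⟫ * ⟪y, cr u c⟫ + ⟪z, u⟫ * ⟪y, u⟫ := by
        intro z hz y
        conv_lhs => rw [hd z hz]
        rw [inner_add_right, inner_smul_right, inner_smul_right]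
      have hsq : ∀ z ∈ W, ⟪z, u⟫ ^ 2 + ⟪z, cr u c⟫ ^ 2 = 1 := by
        intro z hz
        have := hin z hz z
        rw [self_one (hW z hz)] at this
        linarith
      have hnz : ∀ z, IsGab W u z → ⟪z, cr u c⟫ ≠ 0 := by
        intro z hz h0
        have e := hsq z hz.2.1
        rw [h0] at e
        have l1 := inner_lt_one' (hW _ hz.1) (hW _ hz.2.1) hz.2.2.1
        have l2 := neg_one_lt_inner (hW _ hz.1) (hW _ hz.2.1) hz.2.2.2.1
        rw [real_inner_comm] at l1 l2
        nlinarith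
      have k1 := h.2.2.2.2 w' h'.2.1
      have k2 := h'.2.2.2.2 w h.2.1
      rw [inner_add_left, hin w' h'.2.1 w, real_inner_comm w' u, real_inner_comm w u] at k1
      rw [inner_add_left, hin w h.2.1 w', real_inner_comm w' u, real_inner_comm w u] at k2
      have hpos : 0 < ⟪w, cr u c⟫ * ⟪w', cr u c⟫ := by
        by_cases hp : 0 < ⟪w, cr u c⟫
        · exact mul_pos hp (he.mp hp)
        · have a1 := lt_of_le_of_ne (not_lt.mp hp) (hnz w h)
          have a2 := lt_of_le_of_ne (not_lt.mp fun hh => hp (he.mpr hh)) (hnz w' h')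
          exact mul_pos_of_neg_of_neg a1 a2
      have hs := hsq w h.2.1
      have hs' := hsq w' h'.2.1
      have ha : ⟪w, u⟫ = ⟪w', u⟫ := circle_real hs hs' hpos (by nlinarith) (by nlinarith)
      have hb : ⟪w, cr u c⟫ = ⟪w', cr u c⟫ := by
        rw [ha] at hs
        have : (⟪w, cr u c⟫ - ⟪w', cr u c⟫) * (⟪w, cr u c⟫ + ⟪w', cr u c⟫) = 0 := by
          linarith
        rcases mul_eq_zero.mp this with h0 | h0
        · linarith
        · nlinarith
      rw [hd w h.2.1, hd w' h'.2.1, ha, hb]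
  simpa [Finset.card_product, mul_comm] using hle

lemma sym_bound {W : Finset (Euc 3)} (hW : Sph W) (hs : ∀ x ∈ W, -x ∈ W) (hne : W.Nonempty) :
    2 * (Gab W).card + 24 ≤ 15 * W.card := by
  have hneg : ∀ x ∈ W, x ≠ -x := by
    intro x hx h
    have h1 := self_one (hW x hx)
    have h2 : ⟪x, x⟫ = ⟪x, -x⟫ := congrArg (fun z => ⟪x, z⟫) h
    rw [inner_neg_right] at h2
    linarith
  have h2 : 2 ≤ W.card := by
    obtain ⟨x, hx⟩ := hne
    exact Finset.one_lt_card.mpr ⟨x, hx, -x, hs x hx, hneg x hx⟩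
  by_cases hF : Full W
  · exact full_bound hW hF h2
  · simp only [Full] at hF
    push Not at hF
    obtain ⟨c, hc, hcW⟩ := hF
    have hcW' : ∀ x ∈ W, ⟪c, x⟫ = 0 := by
      intro x hx
      have := hcW (-x) (hs x hx)
      rw [inner_neg_right] at this
      linarith [hcW x hx]
    have hn : 0 < ‖c‖ := norm_pos_iff.mpr hc
    have hb := coplanar_bound hW (c := ‖c‖⁻¹ • c)
      (by apply self_one; rw [norm_smul, norm_inv, norm_norm, inv_mul_cancel₀ hn.ne'])
      (by intro x hx; rw [inner_smul_left, hcW' x hx, mul_zero])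
    rcases (Gab W).eq_empty_or_nonempty with h0 | ⟨⟨u, w⟩, h⟩
    · rw [h0, Finset.card_empty]; omega
    · rw [mem_Gab] at h
      have : 2 < W.card := Finset.two_lt_card_iff.mpr ⟨u, w, -u, h.1, h.2.1, hs _ h.1,
        h.2.2.1, hneg _ h.1, fun e => h.2.2.2.1 (by rw [e, neg_neg])⟩
      omega

/-! ## Main theorem -/

lemma dn_gab {V : Finset (Euc 3)} (hV : Sph V) {p q : Euc 3} (h : IsDNPair V p q)
    (hpq : p ≠ -q) : IsGab (V ∪ V.image (fun x => -x)) p (-q) := by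
  obtain ⟨hp, hq, hne, hall⟩ := h
  have hp1 := self_one (hV p hp)
  have hq1 := self_one (hV q hq)
  have key : ∀ v ∈ V, ⟪p, v⟫ - ⟪q, v⟫ ≤ 1 - ⟪p, q⟫ ∧ ⟪q, v⟫ - ⟪p, v⟫ ≤ 1 - ⟪p, q⟫ := by
    intro v hv
    obtain ⟨h1, h2⟩ := hall v hv
    simp only [inner_sub_left, inner_sub_right, hp1, hq1, real_inner_comm p q,
      real_inner_comm p v, real_inner_comm q v] at h1 h2
    constructor <;> linarith
  refine ⟨by simp [hp], by simp [hq], hpq, by simpa using hne, ?_⟩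
  intro x hx
  rw [Finset.mem_union, Finset.mem_image] at hx
  rcases hx with hx | ⟨y, hy, rfl⟩
  · have := (key x hx).1
    simp only [inner_add_left, inner_neg_left, inner_neg_right]; linarith
  · have := (key y hy).2
    simp only [inner_add_left, inner_neg_left, inner_neg_right]; linarith

/-- A set of `n ≥ 8` points on the unit sphere has at most `(17/4)n - 6` double-normal
pairs. -/
theorem doubleNormal_sphere_upper_bound (V : Finset (Euc 3))
    (hV : ∀ v ∈ V, ‖v‖ = 1) (hcard : 8 ≤ V.card) :
    (numDN V : ℝ) ≤ 17 / 4 * V.card - 6 := by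
  have hV : Sph V := hV
  set nV := V.image (fun x => -x) with hnV
  have hmem : ∀ x, x ∈ nV ↔ -x ∈ V := by
    intro x
    rw [hnV, Finset.mem_image]
    constructor
    · rintro ⟨y, hy, rfl⟩; rwa [neg_neg]
    · intro h; exact ⟨-x, h, neg_neg x⟩
  have hnc : nV.card = V.card := Finset.card_image_of_injective _ neg_injective
  set W := V ∪ nV with hWd
  set D := V ∩ nV with hDd
  have hWD : W.card + D.card = 2 * V.card := by
    rw [hWd, hDd, Finset.card_union_add_card_inter, hnc]; ring
  have hDV : D.card ≤ V.card := Finset.card_le_card Finset.inter_subset_left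
  have hWs : Sph W := by
    intro x hx
    rw [hWd, Finset.mem_union, hmem] at hx
    rcases hx with h | h
    · exact hV x h
    · have := hV _ h; rwa [norm_neg] at this
  have hDs : Sph D := fun x hx => hV x (Finset.mem_inter.mp hx).1
  have hWn : ∀ x ∈ W, -x ∈ W := by
    intro x hx
    rw [hWd, Finset.mem_union, hmem] at hx ⊢
    rw [neg_neg]; exact hx.symm
  have hDn : ∀ x ∈ D, -x ∈ D := by
    intro x hx
    rw [hDd, Finset.mem_inter, hmem] at hx ⊢
    rw [neg_neg]; exact hx.symm
  have bW := sym_bound hWs hWn (by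
    apply Finset.card_pos.mp; omega)
  have bD : D.card = 0 ∧ (Gab D).card = 0 ∨ 2 * (Gab D).card + 24 ≤ 15 * D.card := by
    rcases D.eq_empty_or_nonempty with h | h
    · left; rw [h]; simp [Gab]
    · right; exact sym_bound hDs hDn h
  set A := (Gab W).filter fun p => p.1 ∈ V ∧ p.2 ∈ nV with hA
  set A' := A.image Prod.swap with hA'
  have hAc : A'.card = A.card := Finset.card_image_of_injective _ Prod.swap_injective
  have hA'm : ∀ u w, (u, w) ∈ A' → IsGab W u w ∧ u ∈ nV ∧ w ∈ V := by
    intro u w h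
    rw [hA', Finset.mem_image] at h
    obtain ⟨⟨a, b⟩, h, he⟩ := h
    simp only [Prod.swap_prod_mk, Prod.mk.injEq] at he
    obtain ⟨rfl, rfl⟩ := he
    rw [hA, Finset.mem_filter, mem_Gab] at h
    exact ⟨h.1.symm, h.2.2, h.2.1⟩
  have c1 : (A ∪ A').card ≤ (Gab W).card := by
    apply Finset.card_le_card
    rintro ⟨u, w⟩ h
    rw [Finset.mem_union] at h
    rcases h with h | h
    · exact (Finset.mem_filter.mp h).1
    · exact mem_Gab.mpr (hA'm u w h).1
  have c2 : (A ∩ A').card ≤ (Gab D).card := by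
    apply Finset.card_le_card
    rintro ⟨u, w⟩ h
    rw [Finset.mem_inter] at h
    obtain ⟨-, hu, hw⟩ := hA'm u w h.2
    have h1 := h.1
    rw [hA, Finset.mem_filter, mem_Gab] at h1
    obtain ⟨hg, hu', hw'⟩ := h1
    rw [mem_Gab]
    refine ⟨Finset.mem_inter.mpr ⟨hu', hu⟩, Finset.mem_inter.mpr ⟨hw, hw'⟩, hg.2.2.1,
      hg.2.2.2.1, fun x hx => hg.2.2.2.2 x ?_⟩
    exact Finset.mem_union_left _ (Finset.mem_inter.mp hx).1
  have c3 := Finset.card_union_add_card_inter A A'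
  set P := (V ×ˢ V).filter fun pq => IsDNPair V pq.1 pq.2 with hP
  have d1 : (P.filter fun pq => pq.1 = -pq.2).card ≤ D.card := by
    apply Finset.card_le_card_of_injOn Prod.fst
    · rintro ⟨p, q⟩ h
      rw [Finset.mem_coe, Finset.mem_filter, hP, Finset.mem_filter] at h
      obtain ⟨⟨-, h1⟩, h2⟩ := h
      dsimp only at h1 h2
      rw [Finset.mem_coe, hDd, Finset.mem_inter, hmem]
      refine ⟨h1.1, ?_⟩
      dsimp only
      rw [h2, neg_neg]; exact h1.2.1
    · rintro ⟨p, q⟩ h ⟨p', q'⟩ h' he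
      rw [Finset.mem_coe, Finset.mem_filter] at h h'
      have e1 := h.2
      have e2 := h'.2
      dsimp only at e1 e2 he
      have : -q = -q' := by rw [← e1, ← e2, he]
      rw [he, neg_injective this]
  have d2 : (P.filter fun pq => ¬ pq.1 = -pq.2).card ≤ A.card := by
    apply Finset.card_le_card_of_injOn (fun pq => (pq.1, -pq.2))
    · rintro ⟨p, q⟩ h
      rw [Finset.mem_coe, Finset.mem_filter, hP, Finset.mem_filter] at h
      obtain ⟨⟨-, h1⟩, h2⟩ := h
      dsimp only at h1 h2
      rw [Finset.mem_coe, hA, Finset.mem_filter, mem_Gab]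
      refine ⟨dn_gab hV h1 h2, h1.1, ?_⟩
      rw [hmem, neg_neg]; exact h1.2.1
    · rintro ⟨p, q⟩ h ⟨p', q'⟩ h' he
      simpa using he
  have d3 := Finset.card_filter_add_card_filter_not (s := P) (fun pq => pq.1 = -pq.2)
  have hfin : 4 * numDN V + 24 ≤ 17 * V.card := by
    have : numDN V = P.card / 2 := rfl
    omega
  have hfin' : (4 : ℝ) * numDN V + 24 ≤ 17 * V.card := by exact_mod_cast hfin
  linarith
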